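/- Fourth Abel-type identity: Define A(φ, d) := 1 if d = 1 and A(φ, d) := φ·(φ + log d)^{Ω(d) - 1} if d ≥ 2. Then for every positive integer n and every real number φ: φ^{Ω(n)} = ∑_{d | n} (n choose d)_f · A(φ, d) · (-(log d))^{Ω(n/d)}. -/

import Mathlib

open Finset ArithmeticFunction

/-- The factorization binomial coefficient
`(n choose d)_f = ∏_{p prime} C(ν_p(n), ν_p(d)) = f(n)/(f(d)·f(n/d))`,
where `f(n) = ∏_p (ν_p(n))!`. -/
def fChoose (n d : ℕ) : ℕ :=
  ∏ p ∈ n.primeFactors, Nat.choose (padicValNat p n) (padicValNat p d)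

/-- The Abel-type factor `A(φ, d) = φ·(φ + ln d)^{Ω(d)-1}` for `d ≥ 2`,
with `A(φ, 1) = 1`. -/
noncomputable def abelFactor (φ : ℝ) (d : ℕ) : ℝ :=
  if d = 1 then 1 else φ * (φ + Real.log d) ^ (cardFactors d - 1)

/-- Pascal recursion for sums weighted by `fChoose`. -/
theorem fChoose_sum_mul (p n : ℕ) (hp : p.Prime) (hn : 0 < n) (g : ℕ → ℝ) :
    ∑ d ∈ (p * n).divisors, (fChoose (p * n) d : ℝ) * g d =
      ∑ d ∈ n.divisors, (fChoose n d : ℝ) * g d +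
      ∑ d ∈ n.divisors, (fChoose n d : ℝ) * g (p * d) := by
  classical
  have : Fact p.Prime := ⟨hp⟩
  have hn0 : n ≠ 0 := hn.ne'
  have hpn0 : p * n ≠ 0 := mul_ne_zero hp.ne_zero hn0
  obtain ⟨S, hS⟩ : ∃ S, S = (p * n).primeFactors.erase p := ⟨_, rfl⟩
  obtain ⟨R, hR⟩ : ∃ R : ℕ → ℕ, R = fun d => ∏ q ∈ S, Nat.choose (padicValNat q n) (padicValNat q d) :=
    ⟨_, rfl⟩
  have hSq : ∀ q ∈ S, q.Prime ∧ q ≠ p := by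
    intro q hq
    rw [hS, Finset.mem_erase] at hq
    exact ⟨Nat.prime_of_mem_primeFactors hq.2, hq.1⟩
  have hvq : ∀ q ∈ S, ∀ d, d ≠ 0 → padicValNat q (p * d) = padicValNat q d := by
    intro q hq d hd
    have : Fact q.Prime := ⟨(hSq q hq).1⟩
    rw [padicValNat.mul hp.ne_zero hd, padicValNat_primes (hSq q hq).2, zero_add]
  have hvp : ∀ d, d ≠ 0 → padicValNat p (p * d) = padicValNat p d + 1 := by
    intro d hd
    rw [padicValNat.mul hp.ne_zero hd, padicValNat_self, add_comm]
  have hRp : ∀ d, d ≠ 0 → R (p * d) = R d := by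
    intro d hd
    rw [hR]
    exact Finset.prod_congr rfl fun q hq => by rw [hvq q hq d hd]
  have h1 : ∀ d, fChoose (p * n) d
      = Nat.choose (padicValNat p n + 1) (padicValNat p d) * R d := by
    intro d
    have hmem : p ∈ (p * n).primeFactors := by
      rw [Nat.mem_primeFactors]; exact ⟨hp, dvd_mul_right _ _, hpn0⟩
    unfold fChoose
    rw [← Finset.mul_prod_erase _ _ hmem, hvp n hn0, ← hS, hR]
    congr 1
    exact Finset.prod_congr rfl fun q hq => by rw [hvq q hq n hn0]
  have h2 : ∀ d, d ∣ n → fChoose n d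
      = Nat.choose (padicValNat p n) (padicValNat p d) * R d := by
    intro d hd
    have hmem : p ∈ (p * n).primeFactors := by
      rw [Nat.mem_primeFactors]; exact ⟨hp, dvd_mul_right _ _, hpn0⟩
    have hsub : n.primeFactors ⊆ (p * n).primeFactors :=
      Nat.primeFactors_mono (dvd_mul_left _ _) hpn0
    unfold fChoose
    rw [Finset.prod_subset hsub, ← Finset.mul_prod_erase _ _ hmem, ← hS, hR]
    intro q hq hq'
    have hqp := Nat.prime_of_mem_primeFactors hq
    have hqn : ¬ q ∣ n := fun h => hq' (by rw [Nat.mem_primeFactors]; exact ⟨hqp, h, hn0⟩)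
    rw [padicValNat.eq_zero_of_not_dvd hqn,
      padicValNat.eq_zero_of_not_dvd (fun h => hqn (h.trans hd))]
    rfl
  obtain ⟨C, hC⟩ : ∃ C : ℕ → ℕ → ℕ, C = fun a b => if b = 0 then 0 else Nat.choose a (b - 1) :=
    ⟨_, rfl⟩
  have hpas : ∀ a b, Nat.choose (a + 1) b = Nat.choose a b + C a b := by
    intro a b
    rw [hC]
    cases b with
    | zero => simp
    | succ b => simp [Nat.choose_succ_succ, add_comm]
  have e1 : ∑ d ∈ (p * n).divisors, (fChoose (p * n) d : ℝ) * g d =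
      ∑ d ∈ (p * n).divisors, (Nat.choose (padicValNat p n) (padicValNat p d) * R d : ℝ) * g d +
      ∑ d ∈ (p * n).divisors, (C (padicValNat p n) (padicValNat p d) * R d : ℝ) * g d := by
    rw [← Finset.sum_add_distrib]
    refine Finset.sum_congr rfl fun d _ => ?_
    rw [h1, hpas]; push_cast; ring
  rw [e1]
  congr 1
  · symm
    have hsub : n.divisors ⊆ (p * n).divisors := Nat.divisors_subset_of_dvd hpn0 (dvd_mul_left _ _)
    rw [← Finset.sum_subset hsub]
    · refine Finset.sum_congr rfl fun d hd => ?_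
      rw [h2 d (Nat.dvd_of_mem_divisors hd)]; push_cast; ring
    · intro d hd hd'
      have hdd := Nat.dvd_of_mem_divisors hd
      have hd0 : d ≠ 0 := fun h => hpn0 (by rw [h] at hdd; exact zero_dvd_iff.mp hdd)
      have hlt : padicValNat p n < padicValNat p d := by
        by_contra hle
        push Not at hle
        apply hd'
        rw [Nat.mem_divisors]
        refine ⟨?_, hn0⟩
        rw [← Nat.factorization_le_iff_dvd hd0 hn0]
        intro q
        by_cases hq : q = p
        · rw [hq, Nat.factorization_def _ hp, Nat.factorization_def _ hp]; exact hle
        · have := (Nat.factorization_le_iff_dvd hd0 hpn0).2 hdd q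
          rw [Nat.factorization_mul hp.ne_zero hn0, hp.factorization] at this
          simpa [Finsupp.single_apply, Ne.symm hq] using this
      rw [Nat.choose_eq_zero_of_lt hlt]; simp
  · symm
    have hinj : ∀ a ∈ n.divisors, ∀ b ∈ n.divisors, p * a = p * b → a = b :=
      fun a _ b _ h => Nat.eq_of_mul_eq_mul_left hp.pos h
    have hsub : n.divisors.image (fun d => p * d) ⊆ (p * n).divisors := by
      intro x hx
      obtain ⟨d, hd, rfl⟩ := Finset.mem_image.1 hx
      exact Nat.mem_divisors.2 ⟨mul_dvd_mul_left _ (Nat.dvd_of_mem_divisors hd), hpn0⟩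
    rw [← Finset.sum_subset hsub, Finset.sum_image hinj]
    · refine Finset.sum_congr rfl fun d hd => ?_
      have hd0 : d ≠ 0 := (Nat.pos_of_mem_divisors hd).ne'
      rw [h2 d (Nat.dvd_of_mem_divisors hd), hRp d hd0, hvp d hd0, hC]; simp
    · intro d hd hd'
      have hdd := Nat.dvd_of_mem_divisors hd
      have hpd : ¬ p ∣ d := by
        rintro ⟨e, rfl⟩
        exact hd' (Finset.mem_image.2 ⟨e, Nat.mem_divisors.2
          ⟨Nat.dvd_of_mul_dvd_mul_left hp.pos hdd, hn0⟩, rfl⟩)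
      rw [padicValNat.eq_zero_of_not_dvd hpd, hC]; simp

/-- `DegLT k g`: all `k`-fold multiplicative differences of `g` vanish. -/
def DegLT : ℕ → (ℕ → ℝ) → Prop
  | 0, g => ∀ d, 0 < d → g d = 0
  | k + 1, g => ∀ p, p.Prime → DegLT k (fun d => g (p * d) - g d)

theorem DegLT.congr {k : ℕ} : ∀ {g h : ℕ → ℝ}, DegLT k g → (∀ d, 0 < d → g d = h d) →
    DegLT k h := by
  induction k with
  | zero => intro g h hg e d hd; rw [← e d hd]; exact hg d hd
  | succ k ih =>
    intro g h hg e p hp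
    exact ih (hg p hp) fun d hd => by rw [e d hd, e _ (Nat.mul_pos hp.pos hd)]

theorem DegLT.add {k : ℕ} : ∀ {g h : ℕ → ℝ}, DegLT k g → DegLT k h →
    DegLT k (fun d => g d + h d) := by
  induction k with
  | zero => intro g h hg hh d hd; simp [hg d hd, hh d hd]
  | succ k ih =>
    intro g h hg hh p hp
    exact (ih (hg p hp) (hh p hp)).congr fun d _ => by ring

theorem DegLT.smul {k : ℕ} (c : ℝ) : ∀ {g : ℕ → ℝ}, DegLT k g →
    DegLT k (fun d => c * g d) := by
  induction k with
  | zero => intro g hg d hd; simp [hg d hd]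
  | succ k ih =>
    intro g hg p hp
    exact (ih (hg p hp)).congr fun d _ => by ring

theorem DegLT.affine_mul {k : ℕ} : ∀ {g L : ℕ → ℝ} {c : ℕ → ℝ}, DegLT k g →
    (∀ p d, p.Prime → 0 < d → L (p * d) = L d + c p) →
    DegLT (k + 1) (fun d => L d * g d) := by
  induction k with
  | zero =>
    intro g L c hg hL p hp d hd
    simp [hg d hd, hg _ (Nat.mul_pos hp.pos hd)]
  | succ k ih =>
    intro g L c hg hL p hp
    have h1 : DegLT (k + 1) (fun d => (L d + c p) * (g (p * d) - g d)) :=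
      ih (L := fun d => L d + c p) (c := c) (hg p hp) fun q d hq hd => by
        simp only [hL q d hq hd]; ring
    exact (h1.add (hg.smul (c p))).congr fun d hd => by
      simp only [hL p d hp hd]; ring

theorem DegLT.zero (k : ℕ) : DegLT k (fun _ => 0) := by
  induction k with
  | zero => intro d _; rfl
  | succ k ih => intro p _; exact ih.congr fun d _ => by simp

theorem DegLT.sum {k : ℕ} (s : Finset ℕ) (g : ℕ → ℕ → ℝ) (h : ∀ i ∈ s, DegLT k (g i)) :
    DegLT k (fun d => ∑ i ∈ s, g i d) := by
  classical
  induction s using Finset.induction_on with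
  | empty => simpa using DegLT.zero k
  | insert a s ha ih =>
    simp only [Finset.sum_insert ha]
    exact (h a (by simp)).add (ih fun i hi => h i (by simp [hi]))

theorem DegLT.alt_sum (n : ℕ) : 0 < n → ∀ g : ℕ → ℝ, DegLT (cardFactors n) g →
    ∑ d ∈ n.divisors, (fChoose n d : ℝ) * ((-1) ^ cardFactors d * g d) = 0 := by
  induction n using induction_on_primes with
  | zero => intro h; exact absurd h (lt_irrefl _)
  | one => 
    intro _ g hg
    rw [cardFactors_one] at hg
    have h1 : g 1 = 0 := hg 1 one_pos
    simp [h1]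
  | prime_mul p n hp ih =>
    intro hpn g hg
    have hn : 0 < n := Nat.pos_of_mul_pos_left hpn
    rw [cardFactors_mul hp.ne_zero hn.ne', cardFactors_apply_prime hp, add_comm] at hg
    have h := ih hn _ (hg p hp)
    rw [fChoose_sum_mul p n hp hn fun d => (-1) ^ cardFactors d * g d, ← Finset.sum_add_distrib,
      ← neg_eq_zero, ← h, ← Finset.sum_neg_distrib]
    refine Finset.sum_congr rfl fun d hd => ?_
    rw [cardFactors_mul hp.ne_zero (Nat.pos_of_mem_divisors hd).ne', cardFactors_apply_prime hp]
    ring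

/-- The polynomial `C(t - 1, k)`. -/
noncomputable def chooseQ (k : ℕ) (t : ℝ) : ℝ := ((k.factorial : ℝ))⁻¹ * ∏ j ∈ range k, (t - 1 - j)

theorem chooseQ_nat (k t : ℕ) : chooseQ k ((t + 1 : ℕ) : ℝ) = (Nat.choose t k : ℝ) := by
  have h : ∏ j ∈ range k, (((t + 1 : ℕ) : ℝ) - 1 - j) = (t.descFactorial k : ℝ) := by
    induction k with
    | zero => simp
    | succ k ih =>
      rw [Finset.prod_range_succ, ih, Nat.descFactorial_succ]
      rcases le_or_gt k t with h | h
      · push_cast [Nat.cast_sub h]; ring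
      · rw [Nat.descFactorial_eq_zero_iff_lt.2 h]; simp
  rw [chooseQ, h, Nat.descFactorial_eq_factorial_mul_choose]
  have : (k.factorial : ℝ) ≠ 0 := by positivity
  push_cast
  field_simp

theorem chooseQ_zero (k : ℕ) : chooseQ k 0 = (-1) ^ k := by
  have h : ∏ j ∈ range k, ((0 : ℝ) - 1 - j) = (-1) ^ k * (k.factorial : ℝ) := by
    induction k with
    | zero => simp
    | succ k ih => rw [Finset.prod_range_succ, ih, Nat.factorial_succ]; push_cast; ring
  rw [chooseQ, h]
  have : (k.factorial : ℝ) ≠ 0 := by positivity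
  field_simp

theorem degLT_log_pow (k : ℕ) : DegLT (k + 1) (fun d => Real.log d ^ k) := by
  induction k with
  | zero => intro p _ d _; simp
  | succ k ih =>
    refine (ih.affine_mul (L := fun d => Real.log d) (c := fun p => Real.log p) ?_).congr
      fun d _ => by ring
    intro p d hp hd
    have h1 : (p : ℝ) ≠ 0 := by exact_mod_cast hp.ne_zero
    have h2 : (d : ℝ) ≠ 0 := by exact_mod_cast hd.ne'
    push_cast
    rw [Real.log_mul h1 h2, add_comm]

theorem degLT_term (k r : ℕ) :
    DegLT (k + r + 1) (fun d => chooseQ k (cardFactors d : ℝ) * Real.log d ^ r) := by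
  have h : DegLT (k + r + 1)
      (fun d => (∏ j ∈ range k, ((cardFactors d : ℝ) - 1 - j)) * Real.log d ^ r) := by
    induction k with
    | zero => simpa using degLT_log_pow r
    | succ k ih =>
      have := ih.affine_mul (L := fun d => (cardFactors d : ℝ) - 1 - k) (c := fun _ => 1) (by
        intro p d hp hd
        rw [cardFactors_mul hp.ne_zero hd.ne', cardFactors_apply_prime hp]
        push_cast; ring)
      rw [show k + 1 + r + 1 = k + r + 1 + 1 by ring]
      exact this.congr fun d _ => by rw [Finset.prod_range_succ]; ring
  exact (h.smul ((k.factorial : ℝ))⁻¹).congr fun d _ => by rw [chooseQ]; ring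

/-- Binomial expansion of the homogenised term. -/
theorem abel_expand (φ u : ℝ) (t s : ℕ) :
    φ * (φ + u) ^ t * u ^ s =
      ∑ k ∈ range (t + s + 1), φ ^ (k + 1) * (chooseQ k ((t + 1 : ℕ) : ℝ) * u ^ (t + s - k)) := by
  have hsub : range (t + 1) ⊆ range (t + s + 1) := by
    intro x; simp only [Finset.mem_range]; omega
  rw [← Finset.sum_subset hsub, add_pow, Finset.mul_sum, Finset.sum_mul]
  · refine Finset.sum_congr rfl fun k hk => ?_
    have hk' : k ≤ t := by simp only [Finset.mem_range] at hk; omega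
    rw [chooseQ_nat, show t + s - k = (t - k) + s by omega, pow_add]; ring
  · intro k _ hk
    have hk' : t < k := by simp only [Finset.mem_range] at hk; omega
    rw [chooseQ_nat, Nat.choose_eq_zero_of_lt hk']; simp

/-- Fourth Abel-type identity:
`φ^{Ω(n)} = ∑_{d∣n} (n choose d)_f · A(φ, d) · (-ln d)^{Ω(n/d)}`. -/
theorem abel_fourth_identity (n : ℕ) (hn : 0 < n) (φ : ℝ) :
    φ ^ (cardFactors n) =
      ∑ d ∈ n.divisors,
        (fChoose n d : ℝ) * abelFactor φ d * (-(Real.log d)) ^ (cardFactors (n / d)) := by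
  rcases Nat.eq_zero_or_pos (cardFactors n) with hm | hm
  · have h1 : n = 1 := by
      rcases cardFactors_eq_zero_iff_eq_zero_or_one.1 hm with h | h
      · omega
      · exact h
    subst h1
    simp [fChoose, abelFactor]
  obtain ⟨m, hm⟩ : ∃ m, cardFactors n = m + 1 := ⟨cardFactors n - 1, by omega⟩
  obtain ⟨G, hG⟩ : ∃ G : ℕ → ℝ, G = fun d => ∑ k ∈ range (m + 1),
    φ ^ (k + 1) * (chooseQ k (cardFactors d : ℝ) * Real.log d ^ (m - k)) := ⟨_, rfl⟩
  have hdeg : DegLT (cardFactors n) G := by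
    rw [hG, hm]
    refine DegLT.sum _ (fun k d => φ ^ (k + 1) * (chooseQ k (cardFactors d : ℝ) * Real.log d ^ (m - k)))
      fun k hk => ?_
    have hk' : k ≤ m := by simp only [Finset.mem_range] at hk; omega
    have := degLT_term k (m - k)
    rw [show k + (m - k) + 1 = m + 1 by omega] at this
    exact this.smul _
  have h0 := DegLT.alt_sum n hn G hdeg
  have hterm : ∀ d ∈ n.divisors,
      (fChoose n d : ℝ) * abelFactor φ d * (-(Real.log d)) ^ (cardFactors (n / d)) =
      (-1) ^ (m + 1) * ((fChoose n d : ℝ) * ((-1) ^ cardFactors d * G d)) +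
        if d = 1 then φ ^ (m + 1) else 0 := by
    intro d hd
    by_cases h1 : d = 1
    · subst h1
      have hG1 : G 1 = φ ^ (m + 1) * (-1) ^ m := by
        rw [hG]
        simp only
        rw [Finset.sum_range_succ, Finset.sum_eq_zero]
        · simp [chooseQ_zero]
        · intro k hk
          have : m - k ≠ 0 := by simp only [Finset.mem_range] at hk; omega
          simp [this]
      have hf : fChoose n 1 = 1 := by simp [fChoose]
      have hs : ((-1 : ℝ) ^ m) * (-1) ^ m = 1 := by rw [← mul_pow]; simp
      rw [hG1, hf, Nat.div_one, hm]
      simp only [Nat.cast_one, Real.log_one, neg_zero, cardFactors_one, pow_zero, if_true]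
      rw [zero_pow (Nat.succ_ne_zero m), pow_succ (-1 : ℝ) m]
      linear_combination φ ^ (m + 1) * hs
    · obtain ⟨e, he⟩ := Nat.dvd_of_mem_divisors hd
      have hd0 : 0 < d := Nat.pos_of_mem_divisors hd
      have he0 : e ≠ 0 := by rintro rfl; omega
      have hdiv : n / d = e := by rw [he]; exact Nat.mul_div_cancel_left _ hd0
      have hdpos : cardFactors d ≠ 0 := by
        intro h
        rcases cardFactors_eq_zero_iff_eq_zero_or_one.1 h with h | h <;> omega
      obtain ⟨t, ht⟩ : ∃ t, cardFactors d = t + 1 := ⟨cardFactors d - 1, by omega⟩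
      have hsum : m = t + cardFactors e := by
        have := cardFactors_mul hd0.ne' he0
        rw [← he] at this; omega
      have hGd : G d = φ * (φ + Real.log d) ^ t * Real.log d ^ cardFactors e := by
        rw [abel_expand, hG, ← hsum, ← ht]
      rw [hGd, hdiv, ht, abelFactor, if_neg h1, if_neg h1, ht, Nat.add_sub_cancel, hsum,
        neg_pow (Real.log d)]
      have hs : ((-1 : ℝ) ^ t) * (-1) ^ t = 1 := by rw [← mul_pow]; simp
      rw [pow_succ (-1 : ℝ), pow_succ (-1 : ℝ), pow_add (-1 : ℝ)]
      linear_combination (-(fChoose n d : ℝ) * φ * (φ + Real.log d) ^ t * (-1) ^ cardFactors e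
        * Real.log d ^ cardFactors e) * hs
  rw [Finset.sum_congr rfl hterm, Finset.sum_add_distrib, ← Finset.mul_sum, h0, hm,
    Finset.sum_ite_eq' n.divisors 1]
  simp [hn.ne']
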